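/- arXiv:1309.0997 — 4 statements merged into one kernel-verified Lean document; each statement's English description precedes it below -/
import Mathlib

section
/- Let N and p be positive integers with p ≤ N, let R be an N×N real positive definite matrix with positive definite square root R^{1/2}, let H be an N×p real matrix with rank p, and set P = R^{-1/2} H (Hᵀ R⁻¹ H)⁻¹ Hᵀ R^{-1/2}. Let x ∈ ℝ^N satisfy xᵀ R^{-1/2} (I − P) R^{-1/2} x > 0. Define the Gaussian likelihood L(θ, v) = (2π v)^{-N/2} (det R)^{-1/2} exp(−(x − Hθ)ᵀ R⁻¹ (x − Hθ)/(2v)) for θ ∈ ℝ^p and v > 0. Then the generalized likelihood ratio satisfies (sup over θ ∈ ℝ^p and v > 0 of L(θ, v)) divided by (sup over v > 0 of L(0, v)) = ( (xᵀ R⁻¹ x) / (xᵀ R^{-1/2} (I − P) R^{-1/2} x) )^{N/2}. -/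
open Matrix Real

/-- The Gaussian profile `v ↦ (2πv)^{-n} exp(-q/(2v))` is maximal at `v = q/(2n)`. -/
theorem gaussian_profile_le {n q v : ℝ} (hn : 0 < n) (hq : 0 < q) (hv : 0 < v) :
    (2 * π * v) ^ (-n) * Real.exp (-q / (2 * v)) ≤
      (2 * π * (q / (2 * n))) ^ (-n) * Real.exp (-q / (2 * (q / (2 * n)))) := by
  have h1 : 0 < 2 * π * v := by positivity
  have h2 : 0 < 2 * π * (q / (2 * n)) := by positivity
  rw [Real.rpow_def_of_pos h1, Real.rpow_def_of_pos h2, ← Real.exp_add, ← Real.exp_add,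
    Real.exp_le_exp]
  have ht : 0 < q / (2 * n) / v := by positivity
  have hlog := Real.log_le_sub_one_of_pos ht
  have hdiff : Real.log (2 * π * (q / (2 * n))) - Real.log (2 * π * v) =
      Real.log (q / (2 * n) / v) := by
    rw [← Real.log_div h2.ne' h1.ne']
    congr 1
    field_simp
  have e1 : -q / (2 * (q / (2 * n))) = -n := by field_simp
  have e2 : -q / (2 * v) = -n * (q / (2 * n) / v) := by field_simp
  rw [e1, e2]
  nlinarith [mul_le_mul_of_nonneg_left hlog hn.le]

/-- Generalized least squares: the weighted residual form attains its minimum over the column space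
of `H`, with value the quadratic form of `W - W H (Hᵀ W H)⁻¹ Hᵀ W`. -/
theorem weighted_least_squares {m k : Type*} [Fintype m] [DecidableEq m] [Fintype k]
    [DecidableEq k] {W : Matrix m m ℝ} (hW : W.PosDef) {H : Matrix m k ℝ}
    (hH : Function.Injective H.mulVec) (x : m → ℝ) :
    (∃ θ, (x - H *ᵥ θ) ⬝ᵥ W *ᵥ (x - H *ᵥ θ) =
        x ⬝ᵥ (W - W * H * (Hᵀ * W * H)⁻¹ * Hᵀ * W) *ᵥ x) ∧
      ∀ θ, x ⬝ᵥ (W - W * H * (Hᵀ * W * H)⁻¹ * Hᵀ * W) *ᵥ x ≤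
        (x - H *ᵥ θ) ⬝ᵥ W *ᵥ (x - H *ᵥ θ) := by
  have hWt : Wᵀ = W := by simpa using hW.isHermitian.eq
  have hG : (Hᵀ * W * H).PosDef := by
    simpa using hW.conjTranspose_mul_mul_same (B := H) hH
  have hGu : IsUnit (Hᵀ * W * H).det := hG.det_pos.ne'.isUnit
  set G := Hᵀ * W * H with hGdef
  set θ₀ := (G⁻¹ * Hᵀ * W) *ᵥ x with hθ₀
  set r := x - H *ᵥ θ₀ with hr
  have hWr : (W - W * H * G⁻¹ * Hᵀ * W) *ᵥ x = W *ᵥ r := by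
    simp only [hr, hθ₀, sub_mulVec, mulVec_sub, mulVec_mulVec, Matrix.mul_assoc]
  have hnormal : Hᵀ *ᵥ (W *ᵥ r) = 0 := by
    rw [← hWr, mulVec_mulVec]
    have : Hᵀ * (W - W * H * G⁻¹ * Hᵀ * W) = 0 := by
      have : Hᵀ * (W - W * H * G⁻¹ * Hᵀ * W) = Hᵀ * W - G * G⁻¹ * (Hᵀ * W) := by
        simp only [hGdef, Matrix.mul_sub, Matrix.mul_assoc]
      rw [this, mul_nonsing_inv _ hGu, Matrix.one_mul, sub_self]
    rw [this, zero_mulVec]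
  have horth : ∀ d, (H *ᵥ d) ⬝ᵥ W *ᵥ r = 0 := fun d => by
    rw [dotProduct_comm, dotProduct_mulVec, ← mulVec_transpose, hnormal, zero_dotProduct]
  have hx : x = r + H *ᵥ θ₀ := by simp [hr]
  have hQ : x ⬝ᵥ (W - W * H * G⁻¹ * Hᵀ * W) *ᵥ x = r ⬝ᵥ W *ᵥ r := by
    rw [hWr]
    nth_rewrite 1 [hx]
    rw [add_dotProduct, horth, add_zero]
  refine ⟨⟨θ₀, hQ.symm⟩, fun θ => ?_⟩
  have hd : x - H *ᵥ θ = r + H *ᵥ (θ₀ - θ) := by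
    simp only [hr, mulVec_sub]
    abel
  have horth' : r ⬝ᵥ W *ᵥ (H *ᵥ (θ₀ - θ)) = 0 := by
    rw [dotProduct_mulVec, ← mulVec_transpose, hWt, dotProduct_comm, horth]
  have hnn : 0 ≤ (H *ᵥ (θ₀ - θ)) ⬝ᵥ W *ᵥ (H *ᵥ (θ₀ - θ)) := by
    simpa using hW.posSemidef.dotProduct_mulVec_nonneg (H *ᵥ (θ₀ - θ))
  rw [hQ, hd, mulVec_add, add_dotProduct, dotProduct_add, dotProduct_add, horth, horth']
  linarith

/-- The single-sensor generalized likelihood ratio with unknown noise variance equals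
`((xᵀ R⁻¹ x) / (xᵀ R^{-1/2} (I − P) R^{-1/2} x))^{N/2}`. -/
theorem glrt_single_sensor (N p : ℕ) (hN : 0 < N) (hp : 0 < p) (hpN : p ≤ N)
    (R Rhalf : Matrix (Fin N) (Fin N) ℝ) (hR : R.PosDef)
    (hRhalf : Rhalf.PosDef) (hsq : Rhalf * Rhalf = R)
    (H : Matrix (Fin N) (Fin p) ℝ) (hH : H.rank = p)
    (x : Fin N → ℝ)
    (hx : 0 < x ⬝ᵥ (Rhalf⁻¹ * (1 - Rhalf⁻¹ * H * (Hᵀ * R⁻¹ * H)⁻¹ * Hᵀ * Rhalf⁻¹) *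
      Rhalf⁻¹).mulVec x)
    (L : (Fin p → ℝ) → ℝ → ℝ)
    (hL : ∀ (θ : Fin p → ℝ) (v : ℝ),
      L θ v = (2 * π * v) ^ (-(N : ℝ) / 2) * R.det ^ (-(1 : ℝ) / 2) *
        Real.exp (-((x - H.mulVec θ) ⬝ᵥ R⁻¹.mulVec (x - H.mulVec θ)) / (2 * v))) :
    sSup {l : ℝ | ∃ (θ : Fin p → ℝ) (v : ℝ), 0 < v ∧ l = L θ v} /
        sSup {l : ℝ | ∃ v : ℝ, 0 < v ∧ l = L 0 v} =
      ((x ⬝ᵥ R⁻¹.mulVec x) /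
          (x ⬝ᵥ (Rhalf⁻¹ * (1 - Rhalf⁻¹ * H * (Hᵀ * R⁻¹ * H)⁻¹ * Hᵀ * Rhalf⁻¹) *
            Rhalf⁻¹).mulVec x)) ^ ((N : ℝ) / 2) := by
  have hinj : Function.Injective H.mulVec := by
    rw [mulVec_injective_iff, linearIndependent_iff_card_eq_finrank_span, Set.finrank,
      ← rank_eq_finrank_span_cols, hH, Fintype.card_fin]
  have hmat : Rhalf⁻¹ * (1 - Rhalf⁻¹ * H * (Hᵀ * R⁻¹ * H)⁻¹ * Hᵀ * Rhalf⁻¹) * Rhalf⁻¹ =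
      R⁻¹ - R⁻¹ * H * (Hᵀ * R⁻¹ * H)⁻¹ * Hᵀ * R⁻¹ := by
    have hR2 : R⁻¹ = Rhalf⁻¹ * Rhalf⁻¹ := by rw [← hsq, Matrix.mul_inv_rev]
    generalize (Hᵀ * R⁻¹ * H)⁻¹ = K
    rw [hR2]
    simp only [Matrix.mul_sub, Matrix.sub_mul, Matrix.mul_one, Matrix.mul_assoc]
  rw [hmat] at hx ⊢
  obtain ⟨⟨θ₀, hθ₀⟩, hmin⟩ := weighted_least_squares hR.inv hinj x
  set Q := x ⬝ᵥ (R⁻¹ - R⁻¹ * H * (Hᵀ * R⁻¹ * H)⁻¹ * Hᵀ * R⁻¹) *ᵥ x with hQ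
  set q := x ⬝ᵥ R⁻¹ *ᵥ x with hq
  have hq0 : 0 < q := hx.trans_le (by simpa using hmin 0)
  have hn : (0 : ℝ) < N / 2 := by positivity
  have hD : 0 < R.det ^ (-(1 : ℝ) / 2) := Real.rpow_pos_of_pos hR.det_pos _
  set n : ℝ := N / 2 with hndef
  set D := R.det ^ (-(1 : ℝ) / 2) with hDdef
  have hL' : ∀ θ v, L θ v = (2 * π * v) ^ (-n) * Real.exp
      (-((x - H *ᵥ θ) ⬝ᵥ R⁻¹ *ᵥ (x - H *ᵥ θ)) / (2 * v)) * D := fun θ v => by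
    rw [hL, neg_div, mul_right_comm]
  have hL0 : ∀ v, L 0 v = (2 * π * v) ^ (-n) * Real.exp (-q / (2 * v)) * D := fun v => by
    rw [hL', mulVec_zero, sub_zero]
  have hnum : IsGreatest {l : ℝ | ∃ (θ : Fin p → ℝ) (v : ℝ), 0 < v ∧ l = L θ v}
      ((2 * π * (Q / (2 * n))) ^ (-n) * Real.exp (-Q / (2 * (Q / (2 * n)))) * D) := by
    refine ⟨⟨θ₀, Q / (2 * n), by positivity, by rw [hL', hθ₀]⟩, ?_⟩
    rintro _ ⟨θ, v, hv, rfl⟩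
    rw [hL']
    refine mul_le_mul_of_nonneg_right (le_trans ?_ (gaussian_profile_le hn hx hv)) hD.le
    gcongr
    exact hmin θ
  have hden : IsGreatest {l : ℝ | ∃ v : ℝ, 0 < v ∧ l = L 0 v}
      ((2 * π * (q / (2 * n))) ^ (-n) * Real.exp (-q / (2 * (q / (2 * n)))) * D) := by
    refine ⟨⟨q / (2 * n), by positivity, by rw [hL0]⟩, ?_⟩
    rintro _ ⟨v, hv, rfl⟩
    rw [hL0]
    exact mul_le_mul_of_nonneg_right (gaussian_profile_le hn hq0 hv) hD.le
  rw [hnum.csSup_eq, hden.csSup_eq]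
  have e1 : -Q / (2 * (Q / (2 * n))) = -n := by field_simp
  have e2 : -q / (2 * (q / (2 * n))) = -n := by field_simp
  rw [e1, e2, mul_div_mul_right _ _ hD.ne', mul_div_mul_right _ _ (Real.exp_pos _).ne',
    ← Real.div_rpow (by positivity) (by positivity), Real.rpow_neg (by positivity),
    ← Real.inv_rpow (by positivity)]
  congr 1
  field_simp
end

section
/- Let c > 0 and d > 0 be real numbers, and let X and Y be independent real random variables such that X is chi-square distributed with d degrees of freedom and Y is chi-square distributed with c degrees of freedom. Then the law of the random vector (Y, X + Y) has density (w, u) ↦ (u − w)^{d/2 − 1} · w^{c/2 − 1} · e^{−u/2} / ( Γ(d/2) Γ(c/2) 2^{(c+d)/2} ) on the region {(w, u) : 0 < w < u}, and density 0 outside this region, with respect to Lebesgue measure on ℝ². -/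
open MeasureTheory ProbabilityTheory
open scoped ENNReal

/-- A measure on `ℝ` is chi-square with `c` degrees of freedom if it has Lebesgue density
`t ↦ t^{c/2 − 1} e^{−t/2} / (2^{c/2} Γ(c/2))` on `(0, ∞)`. -/
def IsChiSq (ν : Measure ℝ) (c : ℝ) : Prop :=
  ν = volume.withDensity (fun t =>
    if 0 < t then
      ENNReal.ofReal (t ^ (c / 2 - 1) * Real.exp (-t / 2) /
        (2 ^ (c / 2) * Real.Gamma (c / 2)))
    else 0)

/-- A measure preserving map pushes the measure with density `h ∘ T` to the one with density
`h`. -/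
theorem MeasureTheory.MeasurePreserving.map_withDensity_comp {α β : Type*} [MeasurableSpace α]
    [MeasurableSpace β] {μ : Measure α} {ν : Measure β} {T : α → β}
    (hT : MeasurePreserving T μ ν) {h : β → ℝ≥0∞} (hh : Measurable h) :
    Measure.map T (μ.withDensity (h ∘ T)) = ν.withDensity h := by
  ext s hs
  rw [Measure.map_apply hT.measurable hs, withDensity_apply _ (hT.measurable hs),
    withDensity_apply _ hs]
  exact hT.setLIntegral_comp_preimage hs hh

/-- The Lebesgue density of the chi-square law is measurable. -/
theorem measurable_chiSq_density (c : ℝ) : Measurable (fun t : ℝ =>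
    if 0 < t then
      ENNReal.ofReal (t ^ (c / 2 - 1) * Real.exp (-t / 2) /
        (2 ^ (c / 2) * Real.Gamma (c / 2)))
    else 0) :=
  Measurable.ite measurableSet_Ioi (by fun_prop) measurable_const

/-- The density of McKay's bivariate gamma law is measurable. -/
theorem measurable_mckay_density (c d : ℝ) : Measurable (fun p : ℝ × ℝ =>
    if 0 < p.1 ∧ p.1 < p.2 then
      ENNReal.ofReal ((p.2 - p.1) ^ (d / 2 - 1) * p.1 ^ (c / 2 - 1) *
        Real.exp (-p.2 / 2) /
          (Real.Gamma (d / 2) * Real.Gamma (c / 2) * 2 ^ ((c + d) / 2)))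
    else 0) :=
  Measurable.ite ((measurableSet_lt measurable_const measurable_fst).inter
    (measurableSet_lt measurable_fst measurable_snd)) (by fun_prop) measurable_const

/-- If `X ∼ χ²_d` and `Y ∼ χ²_c` are independent, then `(Y, X + Y)` has McKay's bivariate
gamma density `(w, u) ↦ (u − w)^{d/2 − 1} w^{c/2 − 1} e^{−u/2} / (Γ(d/2) Γ(c/2) 2^{(c+d)/2})`
on `{0 < w < u}`. -/
theorem mckay_bivariate_gamma (Ω : Type*) [MeasurableSpace Ω] (μ : Measure Ω)
    [IsProbabilityMeasure μ]
    (c d : ℝ) (hc : 0 < c) (hd : 0 < d)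
    (X Y : Ω → ℝ) (hX : Measurable X) (hY : Measurable Y)
    (hindep : IndepFun X Y μ)
    (hXd : IsChiSq (Measure.map X μ) d) (hYd : IsChiSq (Measure.map Y μ) c) :
    Measure.map (fun ω => (Y ω, X ω + Y ω)) μ =
      volume.withDensity (fun p : ℝ × ℝ =>
        if 0 < p.1 ∧ p.1 < p.2 then
          ENNReal.ofReal ((p.2 - p.1) ^ (d / 2 - 1) * p.1 ^ (c / 2 - 1) *
            Real.exp (-p.2 / 2) /
              (Real.Gamma (d / 2) * Real.Gamma (c / 2) * 2 ^ ((c + d) / 2)))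
        else 0) := by
  have hT : MeasurePreserving (fun z : ℝ × ℝ => (z.2, z.1 + z.2)) volume volume :=
    measurePreserving_prod_add_swap_right volume volume
  have hmap : Measure.map (fun ω => (Y ω, X ω + Y ω)) μ =
      Measure.map (fun z : ℝ × ℝ => (z.2, z.1 + z.2)) (Measure.map (fun ω => (X ω, Y ω)) μ) :=
    (Measure.map_map hT.measurable (hX.prodMk hY)).symm
  rw [hmap, (indepFun_iff_map_prod_eq_prod_map_map hX.aemeasurable hY.aemeasurable).1 hindep,
    hXd, hYd, prod_withDensity (measurable_chiSq_density d) (measurable_chiSq_density c),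
    ← Measure.volume_eq_prod, ← hT.map_withDensity_comp (measurable_mckay_density c d)]
  congr 2
  ext ⟨x, y⟩
  simp only [Function.comp_apply, lt_add_iff_pos_left, add_sub_cancel_right]
  by_cases hx : 0 < x
  · by_cases hy : 0 < y
    · have hΓ := Real.Gamma_pos_of_pos (half_pos hd)
      rw [if_pos hx, if_pos hy, if_pos ⟨hy, hx⟩, ← ENNReal.ofReal_mul (by positivity)]
      congr 1
      rw [show -(x + y) / 2 = -x / 2 + -y / 2 by ring, Real.exp_add,
        show (c + d) / 2 = c / 2 + d / 2 by ring, Real.rpow_add two_pos, div_mul_div_comm]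
      congr 1 <;> ring
    · simp [hy]
  · simp [hx]
end

section
/- Let c > 0 and d > 0 be real numbers, and let X and Y be independent real random variables such that Y is chi-square distributed with c degrees of freedom and X is chi-square distributed with d degrees of freedom. Then the law of Z = (X + Y)/Y has density z ↦ ( Γ((c+d)/2) / (Γ(c/2) Γ(d/2)) ) · (z − 1)^{d/2 − 1} · z^{−(c+d)/2} on (1, ∞), and 0 elsewhere, with respect to Lebesgue measure. -/
open MeasureTheory ProbabilityTheory
open scoped ENNReal

/-- The density of `IsChiSq ν c`. -/
noncomputable def chiSqDensity (c t : ℝ) : ℝ≥0∞ :=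
  if 0 < t then
    ENNReal.ofReal (t ^ (c / 2 - 1) * Real.exp (-t / 2) / (2 ^ (c / 2) * Real.Gamma (c / 2)))
  else 0

lemma chiSqDensity_of_nonpos {c t : ℝ} (ht : t ≤ 0) : chiSqDensity c t = 0 :=
  if_neg ht.not_gt

@[fun_prop]
lemma measurable_chiSqDensity (c : ℝ) : Measurable (chiSqDensity c) := by
  unfold chiSqDensity
  exact Measurable.ite measurableSet_Ioi (by fun_prop) measurable_const

lemma lintegral_eq_mul_lintegral_comp_mul_sub_one {f : ℝ → ℝ≥0∞} (hf : Measurable f) {y : ℝ}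
    (hy : 0 < y) : ∫⁻ x, f x = ENNReal.ofReal y * ∫⁻ z, f (y * (z - 1)) := by
  rw [lintegral_sub_right_eq_self (fun z => f (y * z)) 1]
  conv_lhs => rw [← Real.smul_map_volume_mul_left hy.ne']
  rw [lintegral_smul_measure, lintegral_map hf (measurable_const_mul y), abs_of_pos hy, smul_eq_mul]

/-- For independent `X` and `Y` with densities `f` and `h`, where `h` is supported on `(0, ∞)`,
`(X + Y) / Y` has density `z ↦ ∫ y h(y) f(y (z - 1)) dy`. -/
lemma map_add_div_eq_withDensity {Ω : Type*} [MeasurableSpace Ω] {μ : Measure Ω}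
    [IsProbabilityMeasure μ] {X Y : Ω → ℝ} (hX : Measurable X) (hY : Measurable Y)
    (hindep : IndepFun X Y μ) {f h : ℝ → ℝ≥0∞} (hf : Measurable f) (hh : Measurable h)
    (hh_zero : ∀ y ≤ 0, h y = 0) (hXf : μ.map X = volume.withDensity f)
    (hYh : μ.map Y = volume.withDensity h) :
    μ.map (fun ω => (X ω + Y ω) / Y ω) =
      volume.withDensity (fun z => ∫⁻ y, h y * (ENNReal.ofReal y * f (y * (z - 1)))) := by
  refine Measure.ext_of_lintegral _ fun g hg => ?_
  have hprod : μ.map (fun ω => (X ω, Y ω)) = (μ.map X).prod (μ.map Y) :=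
    (indepFun_iff_map_prod_eq_prod_map_map hX.aemeasurable hY.aemeasurable).1 hindep
  have : IsProbabilityMeasure (μ.map X) := Measure.isProbabilityMeasure_map hX.aemeasurable
  have : IsProbabilityMeasure (μ.map Y) := Measure.isProbabilityMeasure_map hY.aemeasurable
  calc
    ∫⁻ z, g z ∂μ.map (fun ω => (X ω + Y ω) / Y ω)
      = ∫⁻ p, g ((p.1 + p.2) / p.2) ∂μ.map (fun ω => (X ω, Y ω)) := by
        rw [lintegral_map hg (by fun_prop), lintegral_map (by fun_prop) (by fun_prop)]
    _ = ∫⁻ y, h y * ∫⁻ x, f x * g ((x + y) / y) := by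
        rw [hprod, lintegral_prod_symm _ (by fun_prop), hYh,
          lintegral_withDensity_eq_lintegral_mul _ hh
            (Measurable.lintegral_prod_left' (f := fun p : ℝ × ℝ => g ((p.1 + p.2) / p.2))
              (by fun_prop))]
        refine lintegral_congr fun y => ?_
        rw [Pi.mul_apply, hXf, lintegral_withDensity_eq_lintegral_mul _ hf (by fun_prop)]
        rfl
    _ = ∫⁻ y, ∫⁻ z, h y * (ENNReal.ofReal y * f (y * (z - 1))) * g z := by
        refine lintegral_congr fun y => ?_
        rcases le_or_gt y 0 with hy | hy
        · simp [hh_zero y hy]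
        · rw [lintegral_eq_mul_lintegral_comp_mul_sub_one (by fun_prop) hy,
            ← lintegral_const_mul _ (by fun_prop), ← lintegral_const_mul _ (by fun_prop)]
          refine lintegral_congr fun z => ?_
          have hz : (y * (z - 1) + y) / y = z := by field_simp; ring
          rw [hz]
          ring
    _ = ∫⁻ z, ∫⁻ y, h y * (ENNReal.ofReal y * f (y * (z - 1))) * g z :=
        lintegral_lintegral_swap (by fun_prop)
    _ = _ := by
        rw [lintegral_withDensity_eq_lintegral_mul _
          (Measurable.lintegral_prod_right'
            (f := fun p : ℝ × ℝ => h p.2 * (ENNReal.ofReal p.2 * f (p.2 * (p.1 - 1))))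
            (by fun_prop)) hg]
        refine lintegral_congr fun z => ?_
        rw [Pi.mul_apply, lintegral_mul_const _ (by fun_prop)]

lemma chiSqDensity_mul_chiSqDensity {c d y z : ℝ} (hc : 0 < c) (hd : 0 < d) (hy : 0 < y)
    (hz : 1 < z) :
    chiSqDensity c y * (ENNReal.ofReal y * chiSqDensity d (y * (z - 1))) =
      ENNReal.ofReal (Real.Gamma ((c + d) / 2) / (Real.Gamma (c / 2) * Real.Gamma (d / 2)) *
        ((z - 1) ^ (d / 2 - 1) * z ^ (-((c + d) / 2)))) * gammaPDF ((c + d) / 2) (z / 2) y := by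
  have hz1 : 0 < z - 1 := sub_pos.2 hz
  have hz0 : 0 < z := zero_lt_one.trans hz
  have hGc := Real.Gamma_pos_of_pos (half_pos hc)
  have hGd := Real.Gamma_pos_of_pos (half_pos hd)
  have hG := Real.Gamma_pos_of_pos (half_pos (add_pos hc hd))
  rw [chiSqDensity, if_pos hy, chiSqDensity, if_pos (mul_pos hy hz1), gammaPDF_of_nonneg hy.le,
    ← ENNReal.ofReal_mul hy.le, ← ENNReal.ofReal_mul (by positivity),
    ← ENNReal.ofReal_mul (by positivity)]
  congr 1
  have hexp : Real.exp (-(z / 2 * y)) = Real.exp (-y / 2) * Real.exp (-(y * (z - 1)) / 2) := by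
    rw [← Real.exp_add]
    ring_nf
  have hpow : y ^ ((c + d) / 2 - 1) = y ^ (c / 2 - 1) * y * y ^ (d / 2 - 1) := by
    rw [← Real.rpow_add_one hy.ne', ← Real.rpow_add hy]
    ring_nf
  have htwo : (2 : ℝ) ^ ((c + d) / 2) = 2 ^ (c / 2) * 2 ^ (d / 2) := by
    rw [← Real.rpow_add two_pos]
    ring_nf
  rw [hexp, hpow, Real.mul_rpow hy.le hz1.le, Real.div_rpow hz0.le two_pos.le, htwo,
    Real.rpow_neg hz0.le]
  field_simp

lemma lintegral_chiSqDensity_mul_chiSqDensity {c d : ℝ} (hc : 0 < c) (hd : 0 < d) (z : ℝ) :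
    ∫⁻ y, chiSqDensity c y * (ENNReal.ofReal y * chiSqDensity d (y * (z - 1))) =
      if 1 < z then
        ENNReal.ofReal (Real.Gamma ((c + d) / 2) / (Real.Gamma (c / 2) * Real.Gamma (d / 2)) *
          ((z - 1) ^ (d / 2 - 1) * z ^ (-((c + d) / 2))))
      else 0 := by
  split_ifs with hz
  · rw [← mul_one (ENNReal.ofReal _), ← lintegral_gammaPDF_eq_one (a := (c + d) / 2) (r := z / 2)
      (by linarith) (by linarith), ← lintegral_const_mul' _ _ ENNReal.ofReal_ne_top]
    refine lintegral_congr_ae ?_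
    filter_upwards [Measure.ae_ne volume (0 : ℝ)] with y hy
    rcases hy.lt_or_gt with hy | hy
    · rw [chiSqDensity_of_nonpos hy.le, gammaPDF_of_neg hy, zero_mul, mul_zero]
    · exact chiSqDensity_mul_chiSqDensity hc hd hy hz
  · rw [← lintegral_zero (μ := (volume : Measure ℝ))]
    refine lintegral_congr fun y => ?_
    rcases le_or_gt y 0 with hy | hy
    · rw [chiSqDensity_of_nonpos hy, zero_mul]
    · rw [chiSqDensity_of_nonpos (mul_nonpos_of_nonneg_of_nonpos hy.le (by linarith)), mul_zero,
        mul_zero]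

/-- If `Y ∼ χ²_c` and `X ∼ χ²_d` are independent, then the single-sensor GLRT statistic
`Z = (X + Y)/Y` has Lebesgue density
`z ↦ (Γ((c+d)/2)/(Γ(c/2) Γ(d/2))) (z − 1)^{d/2 − 1} z^{−(c+d)/2}` on `(1, ∞)`. -/
theorem glrt_statistic_null_density (Ω : Type*) [MeasurableSpace Ω] (μ : Measure Ω)
    [IsProbabilityMeasure μ]
    (c d : ℝ) (hc : 0 < c) (hd : 0 < d)
    (X Y : Ω → ℝ) (hX : Measurable X) (hY : Measurable Y)
    (hindep : IndepFun X Y μ)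
    (hXd : IsChiSq (Measure.map X μ) d) (hYd : IsChiSq (Measure.map Y μ) c) :
    Measure.map (fun ω => (X ω + Y ω) / Y ω) μ =
      volume.withDensity (fun z : ℝ =>
        if 1 < z then
          ENNReal.ofReal (Real.Gamma ((c + d) / 2) / (Real.Gamma (c / 2) * Real.Gamma (d / 2)) *
            ((z - 1) ^ (d / 2 - 1) * z ^ (-((c + d) / 2))))
        else 0) := by
  rw [map_add_div_eq_withDensity hX hY hindep (measurable_chiSqDensity d)
    (measurable_chiSqDensity c) (fun _ => chiSqDensity_of_nonpos) hXd hYd]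
  simp_rw [lintegral_chiSqDensity_mul_chiSqDensity hc hd]
end

section
/- Let c > 0 and d > 0 be real numbers, let s be a real number with s < c/2, and let X and Y be independent real random variables such that Y is chi-square distributed with c degrees of freedom and X is chi-square distributed with d degrees of freedom. Then the expectation of ((X + Y)/Y)^s is finite and equals Γ((c+d)/2) · Γ(c/2 − s) / ( Γ(c/2) · Γ((c+d)/2 − s) ). -/
open MeasureTheory ProbabilityTheory
open scoped ENNReal

/-- The power `t ↦ t ^ (p - 1)` on `(0, ∞)`, extended by zero. -/
noncomputable def posPow (p t : ℝ) : ℝ≥0∞ :=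
  if 0 < t then ENNReal.ofReal (t ^ (p - 1)) else 0

@[fun_prop]
lemma measurable_posPow (p : ℝ) : Measurable (posPow p) := by
  unfold posPow
  exact Measurable.ite measurableSet_Ioi (by fun_prop) measurable_const

lemma posPow_of_nonpos (p : ℝ) {t : ℝ} (ht : t ≤ 0) : posPow p t = 0 :=
  if_neg ht.not_gt

lemma posPow_of_pos (p : ℝ) {t : ℝ} (ht : 0 < t) :
    posPow p t = ENNReal.ofReal (t ^ (p - 1)) :=
  if_pos ht

lemma posPow_mul (p : ℝ) {u : ℝ} (hu : 0 < u) (v : ℝ) :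
    posPow p (u * v) = ENNReal.ofReal (u ^ (p - 1)) * posPow p v := by
  rcases le_or_gt v 0 with hv | hv
  · rw [posPow_of_nonpos p hv, posPow_of_nonpos p (mul_nonpos_of_nonneg_of_nonpos hu.le hv),
      mul_zero]
  · rw [posPow_of_pos p hv, posPow_of_pos p (mul_pos hu hv), Real.mul_rpow hu.le hv.le,
      ENNReal.ofReal_mul (by positivity)]

lemma posPow_mul_rpow (p s t : ℝ) :
    posPow p t * ENNReal.ofReal (t ^ s) = posPow (p + s) t := by
  rcases le_or_gt t 0 with ht | ht
  · simp [posPow_of_nonpos _ ht]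
  · rw [posPow_of_pos p ht, posPow_of_pos _ ht, ← ENNReal.ofReal_mul (by positivity),
      ← Real.rpow_add ht]
    ring_nf

lemma lintegral_posPow_mul_exp {p : ℝ} (hp : 0 < p) :
    ∫⁻ t, posPow p t * ENNReal.ofReal (Real.exp (-t / 2)) =
      ENNReal.ofReal (2 ^ p * Real.Gamma p) := by
  have hval := Real.integral_rpow_mul_exp_neg_mul_Ioi hp (r := 1 / 2) (by norm_num)
  have hfi : Integrable (fun t : ℝ => t ^ (p - 1) * Real.exp (-(1 / 2 * t)))
      (volume.restrict (Set.Ioi 0)) := by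
    refine Integrable.of_integral_ne_zero ?_
    rw [hval]
    have := Real.Gamma_pos_of_pos hp
    positivity
  have h : (fun t => posPow p t * ENNReal.ofReal (Real.exp (-t / 2))) =
      (Set.Ioi 0).indicator
        (fun t => ENNReal.ofReal (t ^ (p - 1) * Real.exp (-(1 / 2 * t)))) := by
    ext t
    rcases le_or_gt t 0 with ht | ht
    · simp [posPow_of_nonpos p ht, ht]
    · rw [posPow_of_pos p ht, Set.indicator_of_mem (Set.mem_Ioi.2 ht),
        ← ENNReal.ofReal_mul (by positivity)]
      ring_nf
  rw [h, lintegral_indicator measurableSet_Ioi, ← ofReal_integral_eq_lintegral_ofReal hfi, hval]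
  · norm_num
  · filter_upwards [ae_restrict_mem measurableSet_Ioi] with t ht
    have : (0 : ℝ) < t := ht
    positivity

lemma Real.lintegral_eq_ofReal_mul_lintegral_comp_mul_left {f : ℝ → ℝ≥0∞} (hf : Measurable f)
    {u : ℝ} (hu : 0 < u) :
    ∫⁻ y, f y = ENNReal.ofReal u * ∫⁻ v, f (u * v) := by
  conv_lhs => rw [← Real.smul_map_volume_mul_left hu.ne']
  rw [lintegral_smul_measure, lintegral_map hf (by fun_prop), abs_of_pos hu, smul_eq_mul]

lemma lintegral_posPow_sub_mul_posPow (a b u : ℝ) :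
    ∫⁻ y, posPow b (u - y) * posPow a y =
      posPow (a + b) u * ∫⁻ v, posPow b (1 - v) * posPow a v := by
  rcases le_or_gt u 0 with hu | hu
  · rw [posPow_of_nonpos _ hu, zero_mul, ← lintegral_zero (μ := (volume : Measure ℝ))]
    congr 1 with y
    rcases le_or_gt y 0 with hy | hy
    · simp [posPow_of_nonpos a hy]
    · simp [posPow_of_nonpos b (show u - y ≤ 0 by linarith)]
  · rw [Real.lintegral_eq_ofReal_mul_lintegral_comp_mul_left (by fun_prop) hu,
      ← lintegral_const_mul _ (by fun_prop), ← lintegral_const_mul _ (by fun_prop)]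
    congr 1 with v
    rw [show u - u * v = u * (1 - v) by ring, posPow_mul b hu, posPow_mul a hu,
      posPow_of_pos _ hu,
      show u ^ (a + b - 1) = u * (u ^ (b - 1) * u ^ (a - 1)) by
        nth_rw 2 [← Real.rpow_one u]
        rw [← Real.rpow_add hu, ← Real.rpow_add hu]
        ring_nf,
      ENNReal.ofReal_mul hu.le, ENNReal.ofReal_mul (by positivity)]
    ring

/-- A function of the sum of two variables, integrated against power weights. -/
lemma lintegral_lintegral_posPow_mul_comp_add (a b : ℝ) {f : ℝ → ℝ≥0∞} (hf : Measurable f) :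
    ∫⁻ y, ∫⁻ x, posPow b x * posPow a y * f (x + y) =
      (∫⁻ v, posPow b (1 - v) * posPow a v) * ∫⁻ u, posPow (a + b) u * f u := by
  calc
    _ = ∫⁻ y, ∫⁻ u, posPow b (u - y) * posPow a y * f u := by
      congr 1 with y
      rw [← lintegral_sub_right_eq_self _ y]
      simp
    _ = ∫⁻ u, ∫⁻ y, posPow b (u - y) * posPow a y * f u :=
      lintegral_lintegral_swap (Measurable.aemeasurable (by fun_prop))
    _ = _ := by
      rw [← lintegral_const_mul _ (by fun_prop)]
      congr 1 with u
      rw [lintegral_mul_const _ (by fun_prop), lintegral_posPow_sub_mul_posPow]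
      ring

lemma lintegral_posPow_one_sub_mul_posPow {a b : ℝ} (ha : 0 < a) (hb : 0 < b) :
    ∫⁻ v, posPow b (1 - v) * posPow a v =
      ENNReal.ofReal (Real.Gamma a * Real.Gamma b / Real.Gamma (a + b)) := by
  have hab : 0 < a + b := by positivity
  have key := lintegral_lintegral_posPow_mul_comp_add a b
    (f := fun t => ENNReal.ofReal (Real.exp (-t / 2))) (by fun_prop)
  have hsplit (x y : ℝ) :
      posPow b x * posPow a y * ENNReal.ofReal (Real.exp (-(x + y) / 2)) =
        (posPow a y * ENNReal.ofReal (Real.exp (-y / 2))) *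
          (posPow b x * ENNReal.ofReal (Real.exp (-x / 2))) := by
    rw [show -(x + y) / 2 = -x / 2 + -y / 2 by ring, Real.exp_add,
      ENNReal.ofReal_mul (by positivity)]
    ring
  have hΓa := Real.Gamma_pos_of_pos ha
  have hΓb := Real.Gamma_pos_of_pos hb
  have hΓab := Real.Gamma_pos_of_pos hab
  simp_rw [hsplit] at key
  rw [lintegral_lintegral_mul (by fun_prop) (by fun_prop), lintegral_posPow_mul_exp ha,
    lintegral_posPow_mul_exp hb, lintegral_posPow_mul_exp hab,
    ← ENNReal.ofReal_mul (by positivity)] at key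
  rw [← ENNReal.mul_left_inj (c := ENNReal.ofReal (2 ^ (a + b) * Real.Gamma (a + b)))
    (by simp; positivity) (by simp), ← key, ← ENNReal.ofReal_mul (by positivity),
    Real.rpow_add two_pos]
  congr 1
  field_simp

lemma IsChiSq.eq_withDensity_posPow {ν : Measure ℝ} {c : ℝ} (h : IsChiSq ν c) (hc : 0 < c) :
    ν = volume.withDensity (fun t => ENNReal.ofReal (2 ^ (c / 2) * Real.Gamma (c / 2))⁻¹ *
      (posPow (c / 2) t * ENNReal.ofReal (Real.exp (-t / 2)))) := by
  have hΓ := Real.Gamma_pos_of_pos (half_pos hc)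
  rw [h]
  congr 1 with t
  split_ifs with ht
  · rw [posPow_of_pos _ ht, ← ENNReal.ofReal_mul (by positivity),
      ← ENNReal.ofReal_mul (by positivity), div_eq_inv_mul]
  · rw [posPow_of_nonpos _ (not_lt.1 ht)]
    simp

lemma IsChiSq.ae_pos {ν : Measure ℝ} {c : ℝ} (h : IsChiSq ν c) (hc : 0 < c) :
    ∀ᵐ t ∂ν, 0 < t := by
  rw [h.eq_withDensity_posPow hc, ae_withDensity_iff (by fun_prop)]
  refine ae_of_all _ fun t ht => ?_
  by_contra hn
  simp [posPow_of_nonpos _ (not_lt.1 hn)] at ht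

lemma IsChiSq.lintegral_lintegral_add_div_rpow {ν₁ ν₂ : Measure ℝ} {c d s : ℝ}
    (h₁ : IsChiSq ν₁ d) (h₂ : IsChiSq ν₂ c) (hc : 0 < c) (hd : 0 < d) (hs : s < c / 2) :
    ∫⁻ y, ∫⁻ x, ENNReal.ofReal (((x + y) / y) ^ s) ∂ν₁ ∂ν₂ =
      ENNReal.ofReal (Real.Gamma ((c + d) / 2) * Real.Gamma (c / 2 - s) /
        (Real.Gamma (c / 2) * Real.Gamma ((c + d) / 2 - s))) := by
  have has : 0 < c / 2 - s := by linarith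
  have hb : 0 < d / 2 := by positivity
  have hΓa := Real.Gamma_pos_of_pos (half_pos hc)
  have hΓb := Real.Gamma_pos_of_pos hb
  have hΓas := Real.Gamma_pos_of_pos has
  have hΓs := Real.Gamma_pos_of_pos (add_pos has hb)
  have hΓ := Real.Gamma_pos_of_pos (show 0 < (c + d) / 2 by positivity)
  set k₁ := (2 ^ (d / 2) * Real.Gamma (d / 2))⁻¹ with hk₁
  set k₂ := (2 ^ (c / 2) * Real.Gamma (c / 2))⁻¹ with hk₂
  have hpt (x y : ℝ) :
      (ENNReal.ofReal k₂ * (posPow (c / 2) y * ENNReal.ofReal (Real.exp (-y / 2)))) *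
        ((ENNReal.ofReal k₁ * (posPow (d / 2) x * ENNReal.ofReal (Real.exp (-x / 2)))) *
          ENNReal.ofReal (((x + y) / y) ^ s)) =
      ENNReal.ofReal (k₁ * k₂) * (posPow (d / 2) x * posPow (c / 2 - s) y *
        (ENNReal.ofReal ((x + y) ^ s) * ENNReal.ofReal (Real.exp (-(x + y) / 2)))) := by
    rcases le_or_gt x 0 with hx | hx
    · simp [posPow_of_nonpos _ hx]
    rcases le_or_gt y 0 with hy | hy
    · simp [posPow_of_nonpos _ hy]
    rw [sub_eq_add_neg, ← posPow_mul_rpow, show -(x + y) / 2 = -x / 2 + -y / 2 by ring,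
      Real.exp_add, ENNReal.ofReal_mul (by positivity), ENNReal.ofReal_mul (by positivity),
      div_eq_mul_inv (x + y), Real.mul_rpow (by positivity) (by positivity),
      Real.inv_rpow hy.le, ← Real.rpow_neg hy.le, ENNReal.ofReal_mul (by positivity)]
    ring
  calc
    _ = ∫⁻ y, ∫⁻ x, ENNReal.ofReal (k₁ * k₂) * (posPow (d / 2) x * posPow (c / 2 - s) y *
        (ENNReal.ofReal ((x + y) ^ s) * ENNReal.ofReal (Real.exp (-(x + y) / 2)))) := by
      have hin (y : ℝ) : ∫⁻ x, ENNReal.ofReal (((x + y) / y) ^ s) ∂ν₁ =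
          ∫⁻ x, (ENNReal.ofReal k₁ * (posPow (d / 2) x * ENNReal.ofReal (Real.exp (-x / 2)))) *
            ENNReal.ofReal (((x + y) / y) ^ s) := by
        rw [h₁.eq_withDensity_posPow hd,
          lintegral_withDensity_eq_lintegral_mul _ (by fun_prop) (by fun_prop)]
        rfl
      simp_rw [hin]
      rw [h₂.eq_withDensity_posPow hc, lintegral_withDensity_eq_lintegral_mul _ (by fun_prop)
        (Measurable.lintegral_prod_right (by fun_prop))]
      congr 1 with y
      simp_rw [← hpt]
      rw [lintegral_const_mul _ (by fun_prop)]
      rfl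
    _ = ENNReal.ofReal (k₁ * k₂) *
        ((∫⁻ v, posPow (d / 2) (1 - v) * posPow (c / 2 - s) v) *
          ∫⁻ u, posPow ((c + d) / 2) u * ENNReal.ofReal (Real.exp (-u / 2))) := by
      have hsum (u : ℝ) : posPow ((c + d) / 2) u =
          posPow (c / 2 - s + d / 2) u * ENNReal.ofReal (u ^ s) := by
        rw [posPow_mul_rpow]
        ring_nf
      simp_rw [hsum, mul_assoc (posPow (c / 2 - s + d / 2) _)]
      rw [← lintegral_lintegral_posPow_mul_comp_add _ _
        (f := fun u => ENNReal.ofReal (u ^ s) * ENNReal.ofReal (Real.exp (-u / 2)))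
        (by fun_prop), ← lintegral_const_mul _ (Measurable.lintegral_prod_right (by fun_prop))]
      congr 1 with y
      rw [lintegral_const_mul _ (by fun_prop)]
    _ = _ := by
      rw [lintegral_posPow_one_sub_mul_posPow has hb, lintegral_posPow_mul_exp (by positivity),
        ← ENNReal.ofReal_mul (by positivity), ← ENNReal.ofReal_mul (by positivity),
        show (c + d) / 2 - s = c / 2 - s + d / 2 by ring, hk₁, hk₂,
        show (2 : ℝ) ^ ((c + d) / 2) = 2 ^ (c / 2) * 2 ^ (d / 2) by
          rw [← Real.rpow_add two_pos]; ring_nf]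
      congr 1
      field_simp

/-- The real moments of the null GLRT statistic `Z = (X + Y)/Y` with `Y ∼ χ²_c`, `X ∼ χ²_d`
independent: for `s < c/2`, `E[Z^s] = Γ((c+d)/2) Γ(c/2 − s) / (Γ(c/2) Γ((c+d)/2 − s))`. -/
theorem glrt_statistic_moments (Ω : Type*) [MeasurableSpace Ω] (μ : Measure Ω)
    [IsProbabilityMeasure μ]
    (c d : ℝ) (hc : 0 < c) (hd : 0 < d)
    (s : ℝ) (hs : s < c / 2)
    (X Y : Ω → ℝ) (hX : Measurable X) (hY : Measurable Y)
    (hindep : IndepFun X Y μ)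
    (hXd : IsChiSq (Measure.map X μ) d) (hYd : IsChiSq (Measure.map Y μ) c) :
    Integrable (fun ω => ((X ω + Y ω) / Y ω) ^ s) μ ∧
    ∫ ω, ((X ω + Y ω) / Y ω) ^ s ∂μ =
      Real.Gamma ((c + d) / 2) * Real.Gamma (c / 2 - s) /
        (Real.Gamma (c / 2) * Real.Gamma ((c + d) / 2 - s)) := by
  have hlint : ∫⁻ ω, ENNReal.ofReal (((X ω + Y ω) / Y ω) ^ s) ∂μ =
      ENNReal.ofReal (Real.Gamma ((c + d) / 2) * Real.Gamma (c / 2 - s) /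
        (Real.Gamma (c / 2) * Real.Gamma ((c + d) / 2 - s))) := by
    have := Measure.isProbabilityMeasure_map (μ := μ) hX.aemeasurable
    have := Measure.isProbabilityMeasure_map (μ := μ) hY.aemeasurable
    rw [← hXd.lintegral_lintegral_add_div_rpow hYd hc hd hs,
      ← lintegral_prod (fun p : ℝ × ℝ => ENNReal.ofReal (((p.2 + p.1) / p.1) ^ s))
        (Measurable.aemeasurable (by fun_prop)),
      ← hindep.symm.map_prod_eq_prod_map_map hY.aemeasurable hX.aemeasurable,
      lintegral_map (by fun_prop) (by fun_prop)]
  have hmeas : Measurable fun ω => ((X ω + Y ω) / Y ω) ^ s := by fun_prop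
  have hnonneg : 0 ≤ᵐ[μ] fun ω => ((X ω + Y ω) / Y ω) ^ s := by
    filter_upwards [ae_of_ae_map hX.aemeasurable (hXd.ae_pos hd),
      ae_of_ae_map hY.aemeasurable (hYd.ae_pos hc)] with ω hx hy
    have : 0 < X ω := hx
    have : 0 < Y ω := hy
    positivity
  refine ⟨(lintegral_ofReal_ne_top_iff_integrable hmeas.aestronglyMeasurable hnonneg).1
    (hlint ▸ ENNReal.ofReal_ne_top), ?_⟩
  have hΓa := Real.Gamma_pos_of_pos (half_pos hc)
  have hΓas := Real.Gamma_pos_of_pos (show 0 < c / 2 - s by linarith)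
  have hΓ := Real.Gamma_pos_of_pos (show 0 < (c + d) / 2 by positivity)
  have hΓs := Real.Gamma_pos_of_pos (show 0 < (c + d) / 2 - s by linarith)
  rw [integral_eq_lintegral_of_nonneg_ae hnonneg hmeas.aestronglyMeasurable, hlint,
    ENNReal.toReal_ofReal (by positivity)]
end
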